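/- Let T ≥ 1 be real, let q_1 < q_2 < ⋯ < q_s be all squarefree integers q with 1 < q ≤ T², and let P = π(T²) be the number of primes ≤ T². Then for every h = (h_1, …, h_s) ∈ ℤ^s \ {0}, the distance from h_1 √q_1 + ⋯ + h_s √q_s to the nearest integer satisfies ‖h_1 √q_1 + ⋯ + h_s √q_s‖ ≥ (3 s |h|_∞ T)^{−2^P}, where |h|_∞ = max_i |h_i|. -/

import Mathlib

open Polynomial in
/-- In a finite extension of `ℚ`, a square root of a nonsquare natural number has trace zero. -/
theorem trace_eq_zero_of_sq_eq_natCast {L : Type*} [Field L] [Algebra ℚ L]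
    [FiniteDimensional ℚ L] {y : L} {m : ℕ} (hy : y ^ 2 = m) (hm : ¬ IsSquare m) :
    Algebra.trace ℚ L y = 0 := by
  have hirr : Irreducible (X ^ 2 - C (m : ℚ)) := by
    refine X_pow_sub_C_irreducible_of_prime Nat.prime_two fun b hb => hm ?_
    exact Rat.isSquare_natCast_iff.1 ⟨b, by rw [← hb, sq]⟩
  have hmin : minpoly ℚ y = X ^ 2 - C (m : ℚ) :=
    (minpoly.eq_of_irreducible_of_monic hirr (by simp [hy])
      (monic_X_pow_sub_C _ two_ne_zero)).symm
  have hnext : (X ^ 2 - C (m : ℚ)).nextCoeff = 0 := by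
    rw [nextCoeff_of_natDegree_pos (by rw [natDegree_X_pow_sub_C]; exact two_pos),
      natDegree_X_pow_sub_C, coeff_sub, coeff_X_pow, coeff_C]
    simp
  rw [trace_eq_finrank_mul_minpoly_nextCoeff, hmin, hnext, neg_zero, mul_zero]

/-- Two squarefree natural numbers whose product is a square are equal. -/
theorem Squarefree.eq_of_isSquare_mul {a b : ℕ} (ha : Squarefree a) (hb : Squarefree b)
    (hab : IsSquare (a * b)) : a = b := by
  have key : ∀ {u v : ℕ}, Squarefree v → IsSquare (u * v) → v ∣ u := by
    rintro u v hv ⟨c, hc⟩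
    obtain ⟨k, rfl⟩ := (hv.dvd_pow_iff_dvd two_ne_zero).1 ⟨u, by rw [sq, ← hc, mul_comm]⟩
    refine ⟨k * k, Nat.eq_of_mul_eq_mul_right (Nat.pos_of_ne_zero hv.ne_zero) ?_⟩
    rw [hc]
    ring
  exact Nat.dvd_antisymm (key ha (mul_comm a b ▸ hab)) (key hb hab)

/-- A nonzero algebraic integer all of whose conjugates are bounded by `B` has no conjugate
smaller than `B ^ (1 - n)`, where `n` is the degree of the ambient field. -/
theorem one_le_norm_mul_pow_of_isIntegral {L : Type*} [Field L] [Algebra ℚ L]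
    [FiniteDimensional ℚ L] {x : L} (hx : x ≠ 0) (hint : IsIntegral ℤ x) {B : ℝ}
    (hB : ∀ σ : L →ₐ[ℚ] ℂ, ‖σ x‖ ≤ B) (φ : L →ₐ[ℚ] ℂ) :
    1 ≤ ‖φ x‖ * B ^ (Module.finrank ℚ L - 1) := by
  classical
  obtain ⟨z, hz⟩ := IsIntegrallyClosed.isIntegral_iff.1 (Algebra.isIntegral_norm ℚ hint)
  have hz0 : z ≠ 0 := by
    rintro rfl
    exact hx (Algebra.norm_eq_zero_iff.1 (by rw [← hz, map_zero]))
  have hprod := Algebra.norm_eq_prod_embeddings ℚ ℂ x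
  rw [← hz] at hprod
  have hnorm : ‖(algebraMap ℚ ℂ) (algebraMap ℤ ℚ z)‖ = |(z : ℝ)| := by simp
  calc (1 : ℝ) ≤ |(z : ℝ)| := by exact_mod_cast Int.one_le_abs hz0
    _ = ∏ σ : L →ₐ[ℚ] ℂ, ‖σ x‖ := by rw [← hnorm, hprod, norm_prod]
    _ = ‖φ x‖ * ∏ σ ∈ Finset.univ.erase φ, ‖σ x‖ :=
      (Finset.mul_prod_erase _ _ (Finset.mem_univ φ)).symm
    _ ≤ ‖φ x‖ * B ^ (Module.finrank ℚ L - 1) := by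
      gcongr
      refine (Finset.prod_le_prod (fun σ _ => norm_nonneg _) fun σ _ => hB σ).trans_eq ?_
      rw [Finset.prod_const, Finset.card_erase_of_mem (Finset.mem_univ φ), Finset.card_univ, AlgHom.card]

/-- The square roots of `n` natural numbers generate a field of degree at most `2 ^ n`. -/
theorem exists_intermediateField_sqrt_mem (S : Finset ℕ) :
    ∃ K : IntermediateField ℚ ℝ, FiniteDimensional ℚ K ∧ Module.finrank ℚ K ≤ 2 ^ S.card ∧
      ∀ p ∈ S, Real.sqrt p ∈ K := by
  induction S using Finset.induction_on with
  | empty => exact ⟨⊥, inferInstance, by simp, by simp⟩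
  | insert p S hp ih =>
    obtain ⟨K, hfin, hdeg, hK⟩ := ih
    have hroot : Polynomial.aeval (Real.sqrt p) (Polynomial.X ^ 2 - Polynomial.C (p : ℚ)) = 0 := by
      simp
    have hmonic := Polynomial.monic_X_pow_sub_C (p : ℚ) two_ne_zero
    have hint : IsIntegral ℚ (Real.sqrt p) := ⟨_, hmonic, hroot⟩
    have hfin' := IntermediateField.adjoin.finiteDimensional hint
    refine ⟨K ⊔ IntermediateField.adjoin ℚ {Real.sqrt p}, inferInstance, ?_, ?_⟩
    · refine (IntermediateField.finrank_sup_le _ _).trans ?_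
      rw [Finset.card_insert_of_notMem hp, pow_succ]
      refine Nat.mul_le_mul hdeg ?_
      rw [IntermediateField.adjoin.finrank hint]
      refine (Polynomial.natDegree_le_of_dvd (minpoly.dvd _ _ hroot) hmonic.ne_zero).trans ?_
      rw [Polynomial.natDegree_X_pow_sub_C]
    · intro r hr
      rcases Finset.mem_insert.1 hr with rfl | hr
      · exact (le_sup_right : _ ≤ K ⊔ _) (IntermediateField.mem_adjoin_simple_self ℚ _)
      · exact (le_sup_left : K ≤ _) (hK r hr)

/-- A field containing `√p` for every prime factor `p` of a squarefree `n` contains `√n`. -/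
theorem sqrt_mem_of_squarefree {K : IntermediateField ℚ ℝ} {n : ℕ} (hn : Squarefree n)
    (hK : ∀ p ∈ n.primeFactors, Real.sqrt p ∈ K) : Real.sqrt n ∈ K := by
  rw [← Nat.prod_primeFactors_of_squarefree hn, Nat.cast_prod,
    Real.sqrt_prod _ fun p _ => Nat.cast_nonneg p]
  exact prod_mem hK

/-- An integer combination of square roots of distinct squarefree integers greater than one
is an integer only if all coefficients vanish. -/
theorem sum_mul_sqrt_ne_intCast {L ι : Type*} [Field L] [Algebra ℚ L] [FiniteDimensional ℚ L]
    [Fintype ι] {q : ι → ℕ} (hinj : Function.Injective q) (hsq : ∀ i, Squarefree (q i))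
    (hone : ∀ i, q i ≠ 1) {r : ι → L} (hr : ∀ i, r i ^ 2 = q i) {h : ι → ℤ} (hh : h ≠ 0)
    (n : ℤ) : ∑ i, (h i : L) * r i ≠ n := by
  classical
  obtain ⟨j, hj⟩ := Function.ne_iff.1 hh
  intro heq
  have htr : ∀ i, i ≠ j → Algebra.trace ℚ L (r i * r j) = 0 := fun i hij =>
    trace_eq_zero_of_sq_eq_natCast (m := q i * q j) (by rw [mul_pow, hr, hr, Nat.cast_mul])
      fun hs => hij (hinj ((hsq i).eq_of_isSquare_mul (hsq j) hs))
  have htj : Algebra.trace ℚ L (r j) = 0 := trace_eq_zero_of_sq_eq_natCast (hr j) fun hs =>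
    hone j ((hsq j).eq_of_isSquare_mul squarefree_one (by simpa using hs))
  have hcast : ∀ (z : ℤ) (y : L), Algebra.trace ℚ L (z * y) = z * Algebra.trace ℚ L y := by
    intro z y
    rw [← zsmul_eq_mul, map_zsmul, zsmul_eq_mul]
  have := congrArg (fun y => Algebra.trace ℚ L (y * r j)) heq
  simp only [Finset.sum_mul, map_sum, mul_assoc, hcast, htj, mul_zero] at this
  rw [Finset.sum_eq_single j (fun i _ hij => by rw [htr i hij, mul_zero]) (by simp), ← sq, hr,
    ← map_natCast (algebraMap ℚ L), Algebra.trace_algebraMap] at this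
  have hq := (hsq j).ne_zero
  have hd : Module.finrank ℚ L ≠ 0 := Module.finrank_pos.ne'
  simp [hd, hq] at this
  exact hj (by simpa using this)


/-- If `q₁ < ⋯ < q_s` are all the squarefree integers in `(1, T²]` and `P = π(T²)`, then
any nonzero integer combination of the `√qᵢ` stays at distance at least
`(3 s |h|_∞ T)^(−2^P)` from the nearest integer. -/
theorem sqrt_combination_norm_lower_bound (T : ℝ) (hT : 1 ≤ T)
    (s : ℕ) (q : Fin s → ℕ) (hq_mono : StrictMono q)
    (hq_enum : ∀ n : ℕ, (Squarefree n ∧ 1 < n ∧ (n : ℝ) ≤ T ^ 2) ↔ ∃ i, q i = n)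
    (P : ℕ) (hP : P = Nat.card {p : ℕ | p.Prime ∧ (p : ℝ) ≤ T ^ 2})
    (h : Fin s → ℤ) (hh : h ≠ 0) :
    (3 * s * (↑(Finset.univ.sup fun i => (h i).natAbs)) * T) ^ (-(2 : ℝ) ^ P)
      ≤ |(∑ i, (h i : ℝ) * Real.sqrt (q i))
          - round (∑ i, (h i : ℝ) * Real.sqrt (q i))| := by
  classical
  obtain ⟨j, hj⟩ := Function.ne_iff.1 hh
  have hq := fun i => (hq_enum (q i)).2 ⟨i, rfl⟩
  have hT0 : 0 ≤ T := by linarith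
  set H := Finset.univ.sup fun i => (h i).natAbs
  have hle : ∀ i, (h i).natAbs ≤ H := fun i =>
    Finset.le_sup (f := fun i => (h i).natAbs) (Finset.mem_univ i)
  have hH1 : (1 : ℝ) ≤ H := by
    exact_mod_cast (Nat.one_le_iff_ne_zero.2 (Int.natAbs_ne_zero.2 hj)).trans (hle j)
  have hs1 : (1 : ℝ) ≤ s := by exact_mod_cast j.pos
  have hB1 : 1 ≤ s * (H : ℝ) * T :=
    one_le_mul_of_one_le_of_one_le (one_le_mul_of_one_le_of_one_le hs1 hH1) hT
  set x := ∑ i, (h i : ℝ) * Real.sqrt (q i) with hx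
  set n := round x
  -- the primes up to `T ^ 2` and the field generated by their square roots
  set S := (Finset.range (⌊T ^ 2⌋₊ + 1)).filter Nat.Prime with hS
  have hSmem : ∀ p : ℕ, p ∈ S ↔ p.Prime ∧ (p : ℝ) ≤ T ^ 2 := fun p => by
    rw [hS, Finset.mem_filter, Finset.mem_range, Nat.lt_succ_iff, Nat.le_floor_iff (sq_nonneg T),
      and_comm]
  have hcard : S.card = P := by
    have : {p : ℕ | p.Prime ∧ (p : ℝ) ≤ T ^ 2} = (S : Set ℕ) := by
      ext p; simp [hSmem]
    rw [hP, this]; simp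
  obtain ⟨K, hfin, hdeg, hK⟩ := exists_intermediateField_sqrt_mem S
  have hmem : ∀ i, Real.sqrt (q i) ∈ K := fun i =>
    sqrt_mem_of_squarefree (hq i).1 fun p hp => hK p <| (hSmem p).2
      ⟨Nat.prime_of_mem_primeFactors hp, le_trans
        (by exact_mod_cast Nat.le_of_mem_primeFactors hp) (hq i).2.2⟩
  let r : Fin s → K := fun i => ⟨Real.sqrt (q i), hmem i⟩
  have hr : ∀ i, r i ^ 2 = q i := fun i => Subtype.ext (by simp [r])
  let a : K := ∑ i, (h i : K) * r i - n
  have ha : (a : ℝ) = x - n := by simp [a, r, hx]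
  have ha0 : a ≠ 0 := sub_ne_zero.2 <| sum_mul_sqrt_ne_intCast hq_mono.injective
    (fun i => (hq i).1) (fun i => ne_of_gt (hq i).2.1) hr hh n
  have hint : IsIntegral ℤ a := by
    have hri : ∀ i, IsIntegral ℤ (r i) := fun i =>
      .of_pow two_pos (by rw [hr]; exact isIntegral_natCast _)
    exact .sub (.sum _ fun i _ => .mul (isIntegral_intCast _) (hri i)) (isIntegral_intCast _)
  have hsum : ∀ y : Fin s → ℂ, (∀ i, y i ^ 2 = q i) →
      ‖∑ i, (h i : ℂ) * y i‖ ≤ s * H * T := by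
    intro y hy
    refine (norm_sum_le_of_le (f := fun i => (h i : ℂ) * y i) (n := fun _ => (H : ℝ) * T)
      Finset.univ fun i _ => ?_).trans_eq (by simp [mul_assoc])
    rw [norm_mul]
    have h1 : ‖(h i : ℂ)‖ ≤ H := by
      rw [Complex.norm_intCast, ← Int.cast_abs, ← Int.natCast_natAbs]
      exact_mod_cast hle i
    have h2 : ‖y i‖ ≤ T := by
      refine le_of_sq_le_sq ?_ hT0
      rw [← norm_pow, hy, Complex.norm_natCast]
      exact (hq i).2.2
    gcongr
  have hxle : |x| ≤ s * H * T := by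
    have := hsum (fun i => (Real.sqrt (q i) : ℂ)) fun i => by
      rw [← Complex.ofReal_pow, Real.sq_sqrt (Nat.cast_nonneg _), Complex.ofReal_natCast]
    have hc : ∑ i, (h i : ℂ) * (Real.sqrt (q i) : ℂ) = ((x : ℝ) : ℂ) := by simp [hx]
    rwa [hc, Complex.norm_real, Real.norm_eq_abs] at this
  have hround : |x - n| ≤ 1 / 2 := abs_sub_round x
  have hnle : |(n : ℝ)| ≤ s * H * T + 1 / 2 := by
    have := abs_sub_abs_le_abs_sub (n : ℝ) x
    rw [abs_sub_comm] at this
    linarith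
  have hconj : ∀ σ : K →ₐ[ℚ] ℂ, ‖σ a‖ ≤ 3 * s * H * T := by
    intro σ
    have h1 := hsum (fun i => σ (r i)) fun i => by rw [← map_pow, hr, map_natCast]
    have h2 : σ a = ∑ i, (h i : ℂ) * σ (r i) - n := by simp [a]
    have h3 := norm_sub_le (∑ i, (h i : ℂ) * σ (r i)) (n : ℂ)
    rw [Complex.norm_intCast] at h3
    rw [h2]
    linarith
  let φ : K →ₐ[ℚ] ℂ := (Complex.ofRealAm.restrictScalars ℚ).comp K.val
  have hlow := one_le_norm_mul_pow_of_isIntegral ha0 hint hconj φ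
  have hphi : ‖φ a‖ = |x - n| := by
    rw [← ha, ← Real.norm_eq_abs, ← Complex.norm_real]
    rfl
  rw [hphi] at hlow
  have hB : 1 ≤ 3 * s * (H : ℝ) * T := by linarith
  have hpow : (3 * s * (H : ℝ) * T) ^ (Module.finrank ℚ K - 1) ≤ (3 * s * (H : ℝ) * T) ^ 2 ^ P :=
    pow_le_pow_right₀ hB ((Nat.sub_le _ _).trans (hcard ▸ hdeg))
  have hexp : (2 : ℝ) ^ P = ((2 ^ P : ℕ) : ℝ) := by push_cast; rfl
  rw [hexp, Real.rpow_neg (by linarith), Real.rpow_natCast,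
    inv_le_iff_one_le_mul₀ (by positivity)]
  exact hlow.trans (mul_le_mul_of_nonneg_left hpow (abs_nonneg _))
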